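/- Let a ∈ ℤⁿ \ {0} with n ≥ 2, and let a^⊥ = {b ∈ ℤⁿ : ⟨a,b⟩ = 0}, a lattice of rank n−1 with successive minima λ₁ ≤ ⋯ ≤ λ_{n−1} (for the Euclidean norm). Then there exists a ℤ-basis {b₁,…,b_{n−1}} of a^⊥ such that for each i ∈ {1,…,n−1}, the covolume of the sublattice generated by b₁,…,b_i is at most ∏_{j=1}^{i} λ_j. -/

import Mathlib

open Finset

/-- The covolume of the sublattice of `ℤⁿ` generated by `i` vectors `c`, computed
(via Cauchy–Binet) as the Euclidean norm of the vector of `i × i` minors. -/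
noncomputable def covol {n i : ℕ} (c : Fin i → (Fin n → ℤ)) : ℝ :=
  Real.sqrt (∑ s : {s : Finset (Fin n) // s.card = i},
    (((((Matrix.of c).submatrix id
      (fun j : Fin i => (s.1.orderIsoOfFin s.2 j : Fin n))).det : ℤ) : ℝ)) ^ 2)

/-- The `j`-th successive minimum of the lattice `a^⊥ ⊆ ℤⁿ` for the Euclidean norm:
the smallest `r` such that `a^⊥` contains `j` linearly independent vectors of norm `≤ r`. -/
noncomputable def succMin (n : ℕ) (a : Fin n → ℤ) (j : ℕ) : ℝ :=
  sInf {r : ℝ | ∃ v : Fin j → (Fin n → ℤ), LinearIndependent ℤ v ∧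
    ∀ t, (∑ s, a s * v t s = 0) ∧ Real.sqrt (∑ s, ((v t s : ℝ)) ^ 2) ≤ r}


open exteriorPower in
/-- Hadamard's inequality for decomposable vectors of the exterior power. -/
theorem norm_ιMulti_le_prod_norm {E : Type*} [NormedAddCommGroup E] [InnerProductSpace ℝ E]
    [FiniteDimensional ℝ E] {n : ℕ} (v : Fin n → E) :
    ‖ιMulti ℝ n v‖ ≤ ∏ i, ‖v i‖ := by
  refine abs_le_of_sq_le_sq' ?_ (Finset.prod_nonneg fun _ _ ↦ norm_nonneg _) |>.2
  rw [← real_inner_self_eq_norm_sq, inner_ιMulti_self]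
  by_cases hv : LinearIndependent ℝ v
  · let w : Fin n → Submodule.span ℝ (Set.range v) :=
      fun i ↦ ⟨v i, Submodule.subset_span ⟨i, rfl⟩⟩
    have hd : Module.finrank ℝ (Submodule.span ℝ (Set.range v)) = Fintype.card (Fin n) :=
      finrank_span_eq_card hv
    let b := InnerProductSpace.gramSchmidtOrthonormalBasis hd w
    have hb : b.toBasis.det w = ∏ i, inner ℝ (b i) (w i) :=
      InnerProductSpace.gramSchmidtOrthonormalBasis_det hd w
    have hg : Matrix.gram ℝ v = Matrix.gram ℝ w := rfl
    have hdet : (Matrix.of fun i j ↦ b.repr (w j) i).det = ∏ i, inner ℝ (b i) (w i) := by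
      rw [← hb]; rfl
    rw [hg, Matrix.gram_eq_conjTranspose_mul b, Matrix.det_mul, Matrix.det_conjTranspose, hdet,
      star_trivial, ← sq]
    rw [← sq_abs, Finset.abs_prod]
    refine pow_le_pow_left₀ (Finset.prod_nonneg fun _ _ ↦ abs_nonneg _)
      (Finset.prod_le_prod (fun _ _ ↦ abs_nonneg _) fun i _ ↦ ?_) 2
    simpa using abs_real_inner_le_norm (b i) (w i)
  · rw [not_not.1 (mt Matrix.det_gram_ne_zero_iff_linearIndependent.1 hv)]
    positivity

theorem covol_eq_norm_ιMulti {n i : ℕ} (c : Fin i → Fin n → ℤ) :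
    covol c = ‖exteriorPower.ιMulti ℝ i
      fun j ↦ (WithLp.toLp 2 fun t ↦ (c j t : ℝ) : EuclideanSpace ℝ (Fin n))‖ := by
  let e := (EuclideanSpace.basisFun (Fin n) ℝ).exteriorPower i
  set x := exteriorPower.ιMulti ℝ i
    fun j ↦ (WithLp.toLp 2 fun t ↦ (c j t : ℝ) : EuclideanSpace ℝ (Fin n))
  rw [covol, ← Real.sqrt_sq (norm_nonneg x), ← e.sum_sq_norm_inner_right x]
  refine congrArg Real.sqrt (Finset.sum_equiv (.refl (Set.powersetCard (Fin n) i))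
    (fun _ ↦ iff_of_true (Finset.mem_univ _) (Finset.mem_univ _)) fun s _ ↦ ?_)
  rw [← e.repr_apply_apply, ← e.coe_toBasis_repr_apply, OrthonormalBasis.toBasis_exteriorPower,
    exteriorPower.basis_repr_apply, exteriorPower.ιMultiDual_apply_ιMulti,
    Real.norm_eq_abs, sq_abs]
  exact congrArg (· ^ 2) ((Int.castRingHom ℝ).map_det _)

theorem covol_le_prod {n i : ℕ} (c : Fin i → Fin n → ℤ) :
    covol c ≤ ∏ j, √(∑ t, (c j t : ℝ) ^ 2) := by
  rw [covol_eq_norm_ιMulti]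
  refine (norm_ιMulti_le_prod_norm _).trans_eq ?_
  simp [EuclideanSpace.norm_eq]

theorem covol_le_covol_of_mem_span {n i : ℕ} {v b : Fin i → Fin n → ℤ}
    (hv : LinearIndependent ℤ v) (h : ∀ j, v j ∈ Submodule.span ℤ (Set.range b)) :
    covol b ≤ covol v := by
  choose T hT using fun j ↦ (Submodule.mem_span_range_iff_exists_fun ℤ).1 (h j)
  have hvT : Matrix.of v = Matrix.of T * Matrix.of b := by
    ext j t
    simp [← hT, Matrix.mul_apply]
  have hdet : (Matrix.of T).det ≠ 0 := by
    intro h0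
    obtain ⟨w, hw, hw0⟩ := Matrix.exists_vecMul_eq_zero_iff.2 h0
    refine hw (funext fun j ↦ Fintype.linearIndependent_iff.1 hv w ?_ j)
    have : Matrix.vecMul w (Matrix.of v) = 0 := by
      rw [hvT, ← Matrix.vecMul_vecMul, hw0, Matrix.zero_vecMul]
    rwa [Matrix.vecMul_eq_sum] at this
  refine Real.sqrt_le_sqrt (Finset.sum_le_sum fun s _ ↦ ?_)
  rw [hvT, Matrix.submatrix_mul _ _ _ id _ Function.bijective_id, Matrix.submatrix_id_id,
    Matrix.det_mul]
  have h1 : (1 : ℤ) ≤ (Matrix.of T).det ^ 2 := Int.add_one_le_iff.2 (sq_pos_of_ne_zero hdet)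
  rw [← Int.cast_pow, ← Int.cast_pow, Int.cast_le, mul_pow]
  exact le_mul_of_one_le_left (sq_nonneg _) h1

theorem finrank_ker_dotProduct {n : ℕ} {a : Fin n → ℤ} (ha : a ≠ 0) :
    Module.finrank ℤ (LinearMap.ker (dotProductEquiv ℤ (Fin n) a)) = n - 1 := by
  have h := (LinearMap.ker (dotProductEquiv ℤ (Fin n) a)).finrank_quotient_add_finrank
  rw [(dotProductEquiv ℤ (Fin n) a).quotKerEquivRange.finrank_eq] at h
  have h1 : Module.finrank ℤ (LinearMap.range (dotProductEquiv ℤ (Fin n) a)) ≤ 1 :=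
    (Submodule.finrank_le _).trans_eq (Module.finrank_self ℤ)
  have h2 : Module.finrank ℤ (LinearMap.range (dotProductEquiv ℤ (Fin n) a)) ≠ 0 := by
    rw [Ne, Submodule.finrank_eq_zero, LinearMap.range_eq_bot]
    simpa using ha
  rw [Module.finrank_fin_fun] at h
  omega

/-- The successive minima of the lattice orthogonal to `a` are attained. -/
theorem exists_linearIndependent_le_succMin {n k : ℕ} {a : Fin n → ℤ}
    (hk : k + 1 ≤ Module.finrank ℤ (LinearMap.ker (dotProductEquiv ℤ (Fin n) a))) :
    ∃ v : Fin (k + 1) → Fin n → ℤ, LinearIndependent ℤ v ∧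
      ∀ t, (∑ s, a s * v t s = 0) ∧ √(∑ s, (v t s : ℝ) ^ 2) ≤ succMin n a (k + 1) := by
  let P : ℕ → Prop := fun m ↦ ∃ v : Fin (k + 1) → Fin n → ℤ, LinearIndependent ℤ v ∧
      ∀ t, (∑ s, a s * v t s = 0) ∧ √(∑ s, (v t s : ℝ) ^ 2) ≤ √m
  have key : ∀ r, (∃ v : Fin (k + 1) → Fin n → ℤ, LinearIndependent ℤ v ∧
      ∀ t, (∑ s, a s * v t s = 0) ∧ √(∑ s, (v t s : ℝ) ^ 2) ≤ r) → ∃ m, P m ∧ √m ≤ r := by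
    rintro r ⟨v, hv, h⟩
    have hr : 0 ≤ r := (Real.sqrt_nonneg _).trans (h 0).2
    refine ⟨⌊r ^ 2⌋₊, ⟨v, hv, fun t ↦ ⟨(h t).1, Real.sqrt_le_sqrt ?_⟩⟩,
      Real.sqrt_le_iff.2 ⟨hr, Nat.floor_le (sq_nonneg r)⟩⟩
    obtain ⟨q, hq⟩ := Int.eq_ofNat_of_zero_le (Finset.sum_nonneg fun s _ ↦ sq_nonneg (v t s))
    have hq' : ∑ s, (v t s : ℝ) ^ 2 = q := by exact_mod_cast congrArg (Int.cast : ℤ → ℝ) hq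
    have h2 := (Real.sqrt_le_iff.1 (h t).2).2
    rw [hq'] at h2 ⊢
    exact_mod_cast Nat.le_floor h2
  have hne : {r : ℝ | ∃ v : Fin (k + 1) → (Fin n → ℤ), LinearIndependent ℤ v ∧
      ∀ t, (∑ s, a s * v t s = 0) ∧ √(∑ s, ((v t s : ℝ)) ^ 2) ≤ r}.Nonempty := by
    let e := Module.finBasis ℤ (LinearMap.ker (dotProductEquiv ℤ (Fin n) a))
    let v : Fin (k + 1) → Fin n → ℤ := fun j ↦ e (Fin.castLE hk j)
    refine ⟨∑ t, √(∑ s, (v t s : ℝ) ^ 2), v, ?_, fun t ↦ ⟨?_, ?_⟩⟩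
    · exact (e.linearIndependent.comp _ (Fin.castLE_injective hk)).map' (Submodule.subtype _)
        (Submodule.ker_subtype _)
    · exact (e (Fin.castLE hk t)).2
    · exact Finset.single_le_sum (f := fun t ↦ √(∑ s, (v t s : ℝ) ^ 2))
        (fun _ _ ↦ Real.sqrt_nonneg _) (Finset.mem_univ t)
  classical
  have hP : ∃ m, P m := (key _ hne.some_mem).imp fun _ h ↦ h.1
  obtain ⟨v, hv, h⟩ := Nat.find_spec hP
  refine ⟨v, hv, fun t ↦ ⟨(h t).1, (h t).2.trans (le_csInf hne fun r hr ↦ ?_)⟩⟩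
  obtain ⟨m, hm, hmr⟩ := key r hr
  exact (Real.sqrt_le_sqrt (by exact_mod_cast Nat.find_min' hP hm)).trans hmr

theorem LinearIndependent.card_le_finrank_of_mem {R M ι : Type*} [Ring R] [StrongRankCondition R]
    [AddCommGroup M] [Module R M] [Fintype ι] {v : ι → M} (hv : LinearIndependent R v)
    {N : Submodule R M} [Module.Finite R N] (h : ∀ i, v i ∈ N) :
    Fintype.card ι ≤ Module.finrank R N :=
  (show LinearIndependent R fun i ↦ (⟨v i, h i⟩ : N) from
    .of_comp N.subtype hv).fintype_card_le_finrank

/-- Over `ℤ`, a functional killing `N` and nonzero at `w ∉ N` exists as soon as `N` is saturated. -/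
theorem exists_dual_eq_zero_of_saturated {M : Type*} [AddCommGroup M] [Module.Finite ℤ M]
    {N : Submodule ℤ M} (hN : ∀ (c : ℤ) (x : M), c ≠ 0 → c • x ∈ N → x ∈ N) {w : M} (hw : w ∉ N) :
    ∃ f : M →ₗ[ℤ] ℤ, (∀ x ∈ N, f x = 0) ∧ f w ≠ 0 := by
  have : Module.IsTorsionFree ℤ (M ⧸ N) := by
    refine .of_smul_eq_zero fun c x hx ↦ ?_
    obtain ⟨x, rfl⟩ := N.mkQ_surjective x
    rw [← map_smul, Submodule.mkQ_apply, Submodule.Quotient.mk_eq_zero] at hx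
    by_contra! h
    exact h.2 ((Submodule.Quotient.mk_eq_zero N).2 (hN c x h.1 hx))
  obtain ⟨f, hf⟩ := Module.Projective.exists_dual_ne_zero ℤ
    (mt (Submodule.Quotient.mk_eq_zero N).1 hw)
  refine ⟨f ∘ₗ N.mkQ, fun x hx ↦ ?_, hf⟩
  simp [(Submodule.Quotient.mk_eq_zero N).2 hx]

theorem LinearIndependent.snoc_of_dual {M : Type*} [AddCommGroup M] {k : ℕ} {v : Fin k → M}
    (hv : LinearIndependent ℤ v) {f : M →ₗ[ℤ] ℤ}
    (hf : ∀ y ∈ Submodule.span ℤ (Set.range v), f y = 0) {w : M} (hw : f w ≠ 0) :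
    LinearIndependent ℤ (Fin.snoc v w : Fin (k + 1) → M) := by
  refine hv.finSnoc' v w fun c y hy h ↦ ?_
  simpa [hf y hy, hw] using congrArg f h

theorem span_range_snoc {M : Type*} [AddCommGroup M] {k : ℕ} (b : Fin k → M) (d : M) :
    Submodule.span ℤ (Set.range (Fin.snoc b d : Fin (k + 1) → M)) =
      Submodule.span ℤ {d} ⊔ Submodule.span ℤ (Set.range b) := by
  rw [Fin.range_snoc, Submodule.span_insert]

/-- A basis of a saturated sublattice extends to a basis of the saturated sublattice obtained by
adjoining one more vector. -/
theorem exists_saturated_snoc {M : Type*} [AddCommGroup M] [Module.Finite ℤ M] {k : ℕ}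
    {b : Fin k → M}
    (hN : ∀ (c : ℤ) (x : M), c ≠ 0 → c • x ∈ Submodule.span ℤ (Set.range b) →
      x ∈ Submodule.span ℤ (Set.range b)) {f : M →ₗ[ℤ] ℤ}
    (hf : ∀ y ∈ Submodule.span ℤ (Set.range b), f y = 0) {w : M} (hw : f w ≠ 0) :
    ∃ d : M, f d ≠ 0 ∧
      (∃ c : ℤ, c ≠ 0 ∧ c • d ∈ Submodule.span ℤ {w} ⊔ Submodule.span ℤ (Set.range b)) ∧
      w ∈ Submodule.span ℤ (Set.range (Fin.snoc b d : Fin (k + 1) → M)) ∧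
      ∀ (c : ℤ) (x : M), c ≠ 0 →
        c • x ∈ Submodule.span ℤ (Set.range (Fin.snoc b d : Fin (k + 1) → M)) →
        x ∈ Submodule.span ℤ (Set.range (Fin.snoc b d : Fin (k + 1) → M)) := by
  set N := Submodule.span ℤ (Set.range b)
  let W := Submodule.span ℤ {w} ⊔ N
  let S : Submodule ℤ M := (Submodule.torsion ℤ (M ⧸ W)).comap W.mkQ
  have hS : ∀ x, x ∈ S ↔ ∃ c : ℤ, c ≠ 0 ∧ c • x ∈ W := by
    intro x
    rw [Submodule.mem_comap, Submodule.mem_torsion_iff]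
    constructor
    · rintro ⟨c, hc⟩
      exact ⟨c, nonZeroDivisors.coe_ne_zero c, (Submodule.Quotient.mk_eq_zero W).1 hc⟩
    · rintro ⟨c, hc, h⟩
      exact ⟨⟨c, mem_nonZeroDivisors_of_ne_zero hc⟩, (Submodule.Quotient.mk_eq_zero W).2 h⟩
  have hwS : w ∈ S := (hS w).2 ⟨1, one_ne_zero, by
    rw [one_smul]; exact Submodule.mem_sup_left (Submodule.mem_span_singleton_self w)⟩
  obtain ⟨e, he⟩ := (IsPrincipalIdealRing.principal (S.map f : Ideal ℤ)).principal
  obtain ⟨d, hdS, rfl⟩ : e ∈ S.map f := he ▸ Submodule.mem_span_singleton_self e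
  have hdvd : ∀ x ∈ S, ∃ q : ℤ, q * f d = f x := fun x hx ↦
    Submodule.mem_span_singleton.1 (he.le (Submodule.mem_map_of_mem hx))
  have hd : f d ≠ 0 := by
    intro h
    obtain ⟨q, hq⟩ := hdvd w hwS
    rw [h, mul_zero] at hq
    exact hw hq.symm
  have hker : ∀ x ∈ S, f x = 0 → x ∈ N := by
    intro x hx hfx
    obtain ⟨c, hc, h⟩ := (hS x).1 hx
    obtain ⟨p, hp, y, hy, hpy⟩ := Submodule.mem_sup.1 h
    obtain ⟨q, rfl⟩ := Submodule.mem_span_singleton.1 hp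
    have : q = 0 := by simpa [hf y hy, hfx, hw] using congrArg f hpy
    refine hN c x hc ?_
    rw [← hpy, this]
    simpa using hy
  have hNS : N ≤ S := fun x hx ↦ (hS x).2 ⟨1, one_ne_zero, by
    rw [one_smul]; exact Submodule.mem_sup_right hx⟩
  have hspan : Submodule.span ℤ (Set.range (Fin.snoc b d : Fin (k + 1) → M)) = S := by
    rw [span_range_snoc]
    refine le_antisymm (sup_le (by simpa using hdS) hNS) fun x hx ↦ ?_
    obtain ⟨q, hq⟩ := hdvd x hx
    refine Submodule.mem_sup.2 ⟨q • d, Submodule.mem_span_singleton.2 ⟨q, rfl⟩, x - q • d,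
      hker _ (S.sub_mem hx (S.smul_mem q hdS)) ?_, by abel⟩
    simp [hq]
  refine ⟨d, ?_⟩
  rw [hspan]
  refine ⟨hd, (hS d).1 hdS, hwS, fun c x hc hx ↦ (hS x).2 ?_⟩
  obtain ⟨c', hc', h⟩ := (hS _).1 hx
  exact ⟨c' * c, mul_ne_zero hc' hc, by rwa [mul_smul]⟩

/-- There are `k` independent vectors `v` bounded by the successive minima, together with a basis `b`
of their saturation which is triangular with respect to `v`. -/
theorem exists_triangular_saturated {n : ℕ} {a : Fin n → ℤ} (k : ℕ)
    (hk : k ≤ Module.finrank ℤ (LinearMap.ker (dotProductEquiv ℤ (Fin n) a))) :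
    ∃ v b : Fin k → Fin n → ℤ, LinearIndependent ℤ v ∧ LinearIndependent ℤ b ∧
      (∀ j, b j ∈ LinearMap.ker (dotProductEquiv ℤ (Fin n) a)) ∧
      (∀ j : Fin k, √(∑ s, (v j s : ℝ) ^ 2) ≤ succMin n a (j + 1)) ∧
      (∀ (c : ℤ) (x : Fin n → ℤ), c ≠ 0 → c • x ∈ Submodule.span ℤ (Set.range b) →
        x ∈ Submodule.span ℤ (Set.range b)) ∧
      ∀ i (hi : i ≤ k) (j : Fin i), v (Fin.castLE hi j) ∈
        Submodule.span ℤ (Set.range fun j : Fin i ↦ b (Fin.castLE hi j)) := by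
  induction k with
  | zero =>
    refine ⟨Fin.elim0, Fin.elim0, linearIndependent_empty_type, linearIndependent_empty_type,
      fun j ↦ j.elim0, fun j ↦ j.elim0, fun c x hc hx ↦ ?_, fun i hi j ↦ (Fin.castLE hi j).elim0⟩
    rw [Set.range_eq_empty, Submodule.span_empty, Submodule.mem_bot] at hx ⊢
    exact (smul_eq_zero.1 hx).resolve_left hc
  | succ k ih =>
    obtain ⟨v, b, hv, hb, hbL, hle, hsat, htri⟩ := ih (by omega)
    obtain ⟨u, hu, hu'⟩ := exists_linearIndependent_le_succMin hk
    have hvb : Submodule.span ℤ (Set.range v) ≤ Submodule.span ℤ (Set.range b) := by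
      rw [Submodule.span_le]
      rintro _ ⟨j, rfl⟩
      exact htri k le_rfl j
    obtain ⟨t, ht⟩ : ∃ t, u t ∉ Submodule.span ℤ (Set.range b) := by
      by_contra! h
      have := hu.card_le_finrank_of_mem h
      rw [finrank_span_eq_card hb] at this
      simp at this
    obtain ⟨f, hf, hfu⟩ := exists_dual_eq_zero_of_saturated hsat ht
    obtain ⟨d, hfd, ⟨c, hc, hcd⟩, hud, hsat'⟩ := exists_saturated_snoc hsat hf hfu
    refine ⟨Fin.snoc v (u t), Fin.snoc b d, hv.snoc_of_dual (fun y hy ↦ hf y (hvb hy)) hfu,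
      hb.snoc_of_dual hf hfd, ?_, ?_, hsat', ?_⟩
    · refine Fin.lastCases ?_ fun j ↦ ?_
      · have hW : Submodule.span ℤ {u t} ⊔ Submodule.span ℤ (Set.range b) ≤
            LinearMap.ker (dotProductEquiv ℤ (Fin n) a) := by
          refine sup_le ?_ (Submodule.span_le.2 ?_)
          · simpa [dotProduct] using (hu' t).1
          · rintro _ ⟨j, rfl⟩
            exact hbL j
        have := hW hcd
        rw [LinearMap.mem_ker, map_smul] at this
        simpa [hc] using this
      · simpa using hbL j
    · refine Fin.lastCases ?_ fun j ↦ ?_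
      · simpa using (hu' t).2
      · simpa using hle j
    · intro i hi
      rcases hi.lt_or_eq with hi' | rfl
      · intro j
        have hcast (j : Fin i) :
            Fin.castLE hi j = (Fin.castLE (Nat.le_of_lt_succ hi') j).castSucc := rfl
        simp only [hcast, Fin.snoc_castSucc]
        exact htri i (Nat.le_of_lt_succ hi') j
      · refine Fin.lastCases ?_ fun j ↦ ?_
        · simpa using hud
        · have := hvb (Submodule.subset_span ⟨j, rfl⟩)
          simp only [Fin.castLE_rfl, id, Fin.snoc_castSucc]
          rw [span_range_snoc]
          exact Submodule.mem_sup_right this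

theorem stmt_12 (n : ℕ) (hn : 2 ≤ n) (a : Fin n → ℤ) (ha : a ≠ 0) :
    ∃ b : Fin (n - 1) → (Fin n → ℤ),
      LinearIndependent ℤ b ∧
      (Submodule.span ℤ (Set.range b) : Set (Fin n → ℤ)) =
        {v : Fin n → ℤ | ∑ s, a s * v s = 0} ∧
      ∀ i : Fin (n - 1),
        covol (fun j : Fin (i.1 + 1) => b (Fin.castLE i.isLt j)) ≤
          ∏ j : Fin (i.1 + 1), succMin n a (j.1 + 1) := by
  have hrank := finrank_ker_dotProduct ha
  obtain ⟨v, b, hv, hb, hbL, hle, hsat, htri⟩ := exists_triangular_saturated (n - 1) hrank.ge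
  refine ⟨b, hb, ?_, fun i ↦ ?_⟩
  · suffices Submodule.span ℤ (Set.range b) = LinearMap.ker (dotProductEquiv ℤ (Fin n) a) by
      rw [this]; rfl
    refine le_antisymm (Submodule.span_le.2 ?_) fun x hx ↦ ?_
    · rintro _ ⟨j, rfl⟩
      exact hbL j
    · by_contra hxb
      obtain ⟨f, hf, hfx⟩ := exists_dual_eq_zero_of_saturated hsat hxb
      have hmem : ∀ j, (Fin.snoc b x : Fin (n - 1 + 1) → Fin n → ℤ) j ∈
          LinearMap.ker (dotProductEquiv ℤ (Fin n) a) :=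
        Fin.lastCases (by simpa using hx) fun j ↦ by simpa using hbL j
      have := (hb.snoc_of_dual hf hfx).card_le_finrank_of_mem hmem
      rw [hrank, Fintype.card_fin] at this
      omega
  · refine (covol_le_covol_of_mem_span (hv.comp _ (Fin.castLE_injective i.isLt))
      (htri (i + 1) i.isLt)).trans ((covol_le_prod _).trans ?_)
    exact Finset.prod_le_prod (fun _ _ ↦ Real.sqrt_nonneg _) fun j _ ↦ hle (Fin.castLE i.isLt j)
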